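/- arXiv:1802.06491 — 8 statements merged into one kernel-verified Lean document; each statement's English description precedes it below -/
import Mathlib

section
/- Let R be a commutative Noetherian local ring. Then R is an Artinian Gorenstein ring (i.e., R is Artinian and injective as a module over itself) if and only if every ideal of R is a trace ideal. -/
universe u v

/-- The trace ideal of an `R`-module `M`: the ideal of `R` generated by the images of all
`R`-linear maps `M → R`. -/
def traceIdeal (R : Type u) [CommRing R] (M : Type v) [AddCommGroup M] [Module R M] :
    Ideal R :=
  ⨆ f : M →ₗ[R] R, LinearMap.range f

/-- An ideal `I` of `R` is a trace ideal if `I = traceIdeal R N` for some `R`-module `N`. -/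
def Ideal.IsTraceIdeal {R : Type u} [CommRing R] (I : Ideal R) : Prop :=
  ∃ (N : Type u) (_ : AddCommGroup N) (_ : Module R N), I = traceIdeal R N

/-- A trace ideal contains the image of every linear map from itself to the ring. -/
theorem Ideal.IsTraceIdeal.apply_mem {R : Type u} [CommRing R] {I : Ideal R}
    (hI : I.IsTraceIdeal) (f : I →ₗ[R] R) (x : I) : f x ∈ I := by
  obtain ⟨N, _, _, h⟩ := hI
  have range_le (g : N →ₗ[R] R) : LinearMap.range g ≤ I :=
    (le_iSup (fun g : N →ₗ[R] R ↦ LinearMap.range g) g).trans h.ge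
  have le_map : I ≤ (Submodule.comap f I).map I.subtype := by
    conv_lhs => rw [h]
    refine iSup_le ?_
    rintro g _ ⟨n, rfl⟩
    refine ⟨⟨g n, range_le g ⟨n, rfl⟩⟩, ?_, rfl⟩
    exact range_le (f ∘ₗ g.codRestrict I fun m ↦ range_le g ⟨m, rfl⟩) ⟨n, rfl⟩
  obtain ⟨y, hy, hyx⟩ := le_map x.2
  rwa [← Subtype.ext hyx]

/-- An ideal containing the image of every linear map from itself to the ring is a trace ideal. -/
theorem Ideal.isTraceIdeal_of_apply_mem {R : Type u} [CommRing R] {I : Ideal R}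
    (h : ∀ (f : I →ₗ[R] R) (x : I), f x ∈ I) : I.IsTraceIdeal := by
  refine ⟨I, inferInstance, inferInstance, le_antisymm ?_ (iSup_le ?_)⟩
  · exact fun x hx ↦ Submodule.mem_iSup_of_mem I.subtype ⟨⟨x, hx⟩, rfl⟩
  · rintro f _ ⟨x, rfl⟩
    exact h f x

/-- Over a self-injective ring every ideal is a trace ideal. -/
theorem Ideal.isTraceIdeal_of_injective {R : Type u} [CommRing R] [Module.Injective R R]
    (I : Ideal R) : I.IsTraceIdeal := by
  refine I.isTraceIdeal_of_apply_mem fun f x ↦ ?_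
  obtain ⟨g, hg⟩ := Module.Baer.of_injective ‹Module.Injective R R› I f
  rw [← hg x x.2, ← mul_one (x : R), ← smul_eq_mul, map_smul, smul_eq_mul]
  exact I.mul_mem_right _ x.2

/-- If `span {x}` is a trace ideal, it contains every element annihilated by the annihilator
of `x`. -/
theorem Ideal.IsTraceIdeal.dvd_of_annihilator_le {R : Type u} [CommRing R] {x y : R}
    (hx : (Ideal.span {x}).IsTraceIdeal) (h : ∀ r : R, r * x = 0 → r * y = 0) : x ∣ y := by
  let f := LinearPMap.mkSpanSingleton' (R := R) (S := R) (σ := RingHom.id R) x y h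
  have hf : f ⟨x, Submodule.mem_span_singleton_self x⟩ = y :=
    LinearPMap.mkSpanSingleton'_apply_self x y h _
  rw [← Ideal.mem_span_singleton, ← hf]
  exact hx.apply_mem f.toFun _

/-- A Noetherian local ring in which divisibility is detected by annihilators is Artinian. -/
theorem isArtinianRing_of_dvd_of_annihilator_le {R : Type u} [CommRing R] [IsNoetherianRing R]
    [IsLocalRing R] (H : ∀ x y : R, (∀ r : R, r * x = 0 → r * y = 0) → x ∣ y) :
    IsArtinianRing R := by
  rw [isArtinianRing_iff_isNilpotent_maximalIdeal,
    Ideal.FG.isNilpotent_iff_le_nilradical (IsNoetherian.noetherian _)]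
  intro x hx
  let a : ℕ →o Ideal R :=
    { toFun n := LinearMap.ker (LinearMap.mulRight R (x ^ n))
      monotone' := monotone_nat_of_le_succ fun n r hr ↦ by
        simp only [LinearMap.mem_ker, LinearMap.mulRight_apply] at hr ⊢
        rw [pow_succ, ← mul_assoc, hr, zero_mul] }
  obtain ⟨n, hn⟩ := monotone_stabilizes_iff_noetherian.mpr ‹IsNoetherianRing R› a
  obtain ⟨c, hc⟩ := H (x ^ (n + 1)) (x ^ n) fun r hr ↦ by
    have : r ∈ a n := by
      rw [hn (n + 1) n.le_succ]
      exact hr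
    exact this
  have hu : IsUnit (1 - x * c) := by
    by_contra hu
    have := (IsLocalRing.maximalIdeal R).add_mem ((IsLocalRing.mem_maximalIdeal _).mpr hu)
      (Ideal.mul_mem_right c _ hx)
    rw [sub_add_cancel] at this
    exact (IsLocalRing.mem_maximalIdeal _).mp this isUnit_one
  refine ⟨n, (hu.mul_left_eq_zero).mp ?_⟩
  linear_combination hc

/-- Length of the dual of a module in terms of a submodule and its quotient. -/
theorem Module.length_linearMap_eq_add {R : Type u} [CommRing R] {M : Type v} [AddCommGroup M]
    [Module R M] (N : Submodule R M) :
    Module.length R (M →ₗ[R] R) = Module.length R ((M ⧸ N) →ₗ[R] R) +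
      Module.length R (LinearMap.range (LinearMap.lcomp R R N.subtype)) := by
  refine Module.length_eq_add_of_exact (LinearMap.lcomp R R N.mkQ)
    (LinearMap.lcomp R R N.subtype).rangeRestrict
    (LinearMap.lcomp_injective_of_surjective _ N.mkQ_surjective)
    (LinearMap.surjective_rangeRestrict _) fun f ↦ ⟨fun hf ↦ ?_, ?_⟩
  · refine ⟨N.liftQ f fun x hx ↦ ?_, LinearMap.ext fun x ↦ rfl⟩
    exact LinearMap.congr_fun (congrArg Subtype.val hf) ⟨x, hx⟩
  · rintro ⟨g, rfl⟩
    ext x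
    simp [(Submodule.Quotient.mk_eq_zero N).mpr x.2]

/-- If divisibility is detected by annihilators, the dual of a simple module has length at most
one. -/
theorem Module.length_linearMap_le_one {R : Type u} [CommRing R]
    (H : ∀ x y : R, (∀ r : R, r * x = 0 → r * y = 0) → x ∣ y)
    (S : Type v) [AddCommGroup S] [Module R S] [IsSimpleModule R S] :
    Module.length R (S →ₗ[R] R) ≤ 1 := by
  cases subsingleton_or_nontrivial (S →ₗ[R] R)
  · simp
  refine (Module.length_eq_one_iff.mpr ?_).le
  rw [isSimpleModule_iff_toSpanSingleton_surjective]
  refine ⟨inferInstance, fun f hf g ↦ ?_⟩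
  have inj : Function.Injective f := (LinearMap.injective_or_eq_zero f).resolve_right hf
  have := IsSimpleModule.nontrivial R S
  obtain ⟨x, hx⟩ := exists_ne (0 : S)
  obtain ⟨c, hc⟩ := H (f x) (g x) fun r hr ↦ by
    have : r • x = 0 := inj (by simpa using hr)
    rw [← smul_eq_mul, ← map_smul, this, map_zero]
  refine ⟨c, LinearMap.ext fun y ↦ ?_⟩
  obtain ⟨r, rfl⟩ := IsSimpleModule.toSpanSingleton_surjective R hx y
  simp only [LinearMap.toSpanSingleton_apply, LinearMap.smul_apply, map_smul, smul_eq_mul, hc]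
  ring

/-- If divisibility is detected by annihilators, dualizing does not increase the length. -/
theorem Module.length_linearMap_le {R : Type u} [CommRing R]
    (H : ∀ x y : R, (∀ r : R, r * x = 0 → r * y = 0) → x ∣ y)
    {M : Type v} [AddCommGroup M] [Module R M] (hM : IsFiniteLength R M) :
    Module.length R (M →ₗ[R] R) ≤ Module.length R M := by
  induction hM with
  | of_subsingleton => simp
  | @of_simple_quotient M _ _ N _ _ ih =>
    rw [Module.length_linearMap_eq_add N, Module.length_eq_add_of_exact N.subtype N.mkQ
      N.injective_subtype N.mkQ_surjective (LinearMap.exact_subtype_mkQ N),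
      Module.length_eq_one R (M ⧸ N), add_comm]
    exact add_le_add ((Module.length_le_of_injective _ (Submodule.injective_subtype _)).trans ih)
      (Module.length_linearMap_le_one H _)

/-- An Artinian ring in which divisibility is detected by annihilators is self-injective. -/
theorem Module.injective_of_dvd_of_annihilator_le {R : Type u} [CommRing R] [IsArtinianRing R]
    (H : ∀ x y : R, (∀ r : R, r * x = 0 → r * y = 0) → x ∣ y) : Module.Injective R R := by
  refine Module.Baer.injective (Module.Baer.iff_surjective.mpr fun I ↦ ?_)
  have fin_length (M : Type u) [AddCommGroup M] [Module R M] [Module.Finite R M] :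
      IsFiniteLength R M :=
    isFiniteLength_iff_isNoetherian_isArtinian.mpr ⟨inferInstance, inferInstance⟩
  have hI := Module.length_linearMap_le H (fin_length I)
  have hQ := Module.length_linearMap_le H (fin_length (R ⧸ I))
  have hdual : IsFiniteLength R (I →ₗ[R] R) := Module.length_ne_top_iff.mp
    (ne_top_of_le_ne_top (Module.length_ne_top_iff.mpr (fin_length I)) hI)
  obtain ⟨_, _⟩ := isFiniteLength_iff_isNoetherian_isArtinian.mp hdual
  rw [← LinearMap.range_eq_top]
  by_contra hne
  refine (Submodule.length_lt hne).not_ge (hI.trans ?_)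
  have h₁ := Module.length_linearMap_eq_add I
  rw [(LinearMap.ringLmapEquivSelf R R R).length_eq,
    Module.length_eq_add_of_exact I.subtype I.mkQ I.injective_subtype I.mkQ_surjective
      (LinearMap.exact_subtype_mkQ I), add_comm] at h₁
  exact (ENat.add_le_add_iff_left (Module.length_ne_top_iff.mpr (fin_length (R ⧸ I)))).mp
    (h₁.le.trans (add_le_add_left hQ _))

theorem stmt_0 (R : Type u) [CommRing R] [IsNoetherianRing R] [IsLocalRing R] :
    (IsArtinianRing R ∧ Module.Injective R R) ↔ ∀ I : Ideal R, I.IsTraceIdeal := by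
  refine ⟨fun ⟨_, _⟩ I ↦ I.isTraceIdeal_of_injective, fun h ↦ ?_⟩
  have H (x y : R) : (∀ r : R, r * x = 0 → r * y = 0) → x ∣ y :=
    (h (Ideal.span {x})).dvd_of_annihilator_le
  have := isArtinianRing_of_dvd_of_annihilator_le H
  exact ⟨this, Module.injective_of_dvd_of_annihilator_le H⟩
end

section
/- Let R be a commutative Noetherian local Artinian Gorenstein ring (i.e., R is local, Artinian, and injective as a module over itself) and let M be a finitely generated R-module. Then the trace ideal of M equals its double annihilator: τ_R(M) = Ann_R(Ann_R(M)). -/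
universe u v

/-- A nonzero local Artinian ring has a nonzero element killed by the maximal ideal. -/
theorem IsLocalRing.exists_ne_zero_forall_mem_maximalIdeal_mul_eq_zero (R : Type*) [CommRing R]
    [IsLocalRing R] [IsArtinianRing R] :
    ∃ s : R, s ≠ 0 ∧ ∀ r ∈ IsLocalRing.maximalIdeal R, r * s = 0 := by
  obtain ⟨n, hn⟩ : IsNilpotent (IsLocalRing.maximalIdeal R) := by
    rw [← IsLocalRing.jacobson_eq_maximalIdeal ⊥ bot_ne_top]
    exact IsArtinianRing.isNilpotent_jacobson_bot
  by_contra! h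
  have key : ∀ k : ℕ, ∃ t ∈ IsLocalRing.maximalIdeal R ^ k, t ≠ 0 := by
    intro k
    induction k with
    | zero => exact ⟨1, by simp, one_ne_zero⟩
    | succ k ih =>
      obtain ⟨t, ht, h0⟩ := ih
      obtain ⟨r, hr, hrt⟩ := h t h0
      exact ⟨r * t, pow_succ' (IsLocalRing.maximalIdeal R) k ▸ Ideal.mul_mem_mul hr ht, hrt⟩
  obtain ⟨t, ht, h0⟩ := key n
  rw [hn] at ht
  exact h0 ht

/-- A self-injective local Artinian ring is a cogenerator: linear forms separate points. -/
theorem Module.exists_linearMap_apply_ne_zero_of_injective {R : Type u} [CommRing R]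
    [IsLocalRing R] [IsArtinianRing R] [Module.Injective R R]
    {N : Type v} [AddCommGroup N] [Module R N] {x : N} (hx : x ≠ 0) :
    ∃ f : N →ₗ[R] R, f x ≠ 0 := by
  obtain ⟨s, hs, hms⟩ := IsLocalRing.exists_ne_zero_forall_mem_maximalIdeal_mul_eq_zero R
  let g := LinearMap.toSpanSingleton R N x
  have hle : LinearMap.ker g ≤ LinearMap.ker (LinearMap.toSpanSingleton R R s) := by
    intro r hr
    have hrx : r • x = 0 := by simpa [g] using hr
    refine LinearMap.mem_ker.2 (hms r ((IsLocalRing.mem_maximalIdeal r).2 fun hu ↦ hx ?_))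
    exact hu.smul_eq_zero.1 hrx
  have hi : Function.Injective ((LinearMap.ker g).liftQ g le_rfl) :=
    LinearMap.ker_eq_bot.1 (Submodule.ker_liftQ_eq_bot _ _ _ le_rfl)
  obtain ⟨f, hf⟩ := (Module.Baer.of_injective ‹Module.Injective R R›).extension_property _ hi
    ((LinearMap.ker g).liftQ _ hle)
  refine ⟨f, ?_⟩
  have hfx : f x = s := by
    simpa only [LinearMap.comp_apply, Submodule.liftQ_apply, g, LinearMap.toSpanSingleton_apply,
      one_smul] using LinearMap.congr_fun hf (Submodule.Quotient.mk 1)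
  rwa [hfx]

/-- Every ideal of a self-injective local Artinian ring contains its double annihilator. -/
theorem Ideal.annihilator_annihilator_le_of_injective {R : Type u} [CommRing R]
    [IsLocalRing R] [IsArtinianRing R] [Module.Injective R R] (I : Ideal R) :
    I.annihilator.annihilator ≤ I := by
  intro r hr
  by_contra hrI
  have hx : (Submodule.Quotient.mk r : R ⧸ I) ≠ 0 := by
    rwa [Ne, Submodule.Quotient.mk_eq_zero]
  obtain ⟨f, hf⟩ := Module.exists_linearMap_apply_ne_zero_of_injective (R := R) hx
  have hsmul (a : R) : f (Submodule.Quotient.mk a) = a • f (Submodule.Quotient.mk 1) := by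
    rw [← map_smul, ← Submodule.Quotient.mk_smul, smul_eq_mul, mul_one]
  refine hf ((hsmul r).trans (Submodule.mem_annihilator.1 hr _ ?_))
  refine Submodule.mem_annihilator.2 fun a ha ↦ ?_
  rw [smul_eq_mul, mul_comm, ← smul_eq_mul, ← hsmul, (Submodule.Quotient.mk_eq_zero I).2 ha,
    map_zero]

theorem apply_mem_traceIdeal {R : Type u} [CommRing R] {M : Type v} [AddCommGroup M] [Module R M]
    (f : M →ₗ[R] R) (m : M) : f m ∈ traceIdeal R M :=
  le_iSup (fun f : M →ₗ[R] R ↦ LinearMap.range f) f (LinearMap.mem_range_self f m)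

theorem traceIdeal_le_annihilator_annihilator (R : Type u) [CommRing R]
    (M : Type v) [AddCommGroup M] [Module R M] :
    traceIdeal R M ≤ (Module.annihilator R M).annihilator := by
  refine iSup_le fun f ↦ ?_
  rintro _ ⟨m, rfl⟩
  refine Submodule.mem_annihilator.2 fun a ha ↦ ?_
  rw [smul_eq_mul, mul_comm, ← smul_eq_mul, ← map_smul, Module.mem_annihilator.1 ha, map_zero]

theorem annihilator_traceIdeal_le_of_injective (R : Type u) [CommRing R]
    [IsLocalRing R] [IsArtinianRing R] [Module.Injective R R]
    (M : Type v) [AddCommGroup M] [Module R M] :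
    (traceIdeal R M).annihilator ≤ Module.annihilator R M := by
  refine fun a ha ↦ Module.mem_annihilator.2 fun m ↦ ?_
  by_contra hm
  obtain ⟨f, hf⟩ := Module.exists_linearMap_apply_ne_zero_of_injective (R := R) hm
  exact hf ((map_smul f a m).trans (Submodule.mem_annihilator.1 ha _ (apply_mem_traceIdeal f m)))

theorem stmt_2 (R : Type u) [CommRing R] [IsNoetherianRing R] [IsLocalRing R]
    [IsArtinianRing R] [Module.Injective R R]
    (M : Type v) [AddCommGroup M] [Module R M] [Module.Finite R M] :
    traceIdeal R M = (Module.annihilator R M).annihilator :=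
  le_antisymm (traceIdeal_le_annihilator_annihilator R M)
    ((Submodule.annihilator_mono (annihilator_traceIdeal_le_of_injective R M)).trans
      (Ideal.annihilator_annihilator_le_of_injective _))
end

section
/- Let R be a commutative Noetherian ring and M a cyclic R-module (generated by one element). Then the trace ideal of M equals its double annihilator: τ_R(M) = Ann_R(Ann_R(M)). -/
universe u v

theorem annihilator_annihilator_le_traceIdeal {R : Type u} [CommRing R]
    {M : Type v} [AddCommGroup M] [Module R M] {m : M} (hm : Submodule.span R {m} = ⊤) :
    (Module.annihilator R M).annihilator ≤ traceIdeal R M := by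
  intro r hr
  let g := LinearMap.toSpanSingleton R M m
  have hg : Function.Surjective g := by
    rw [← LinearMap.range_eq_top, LinearMap.range_toSpanSingleton, hm]
  have hker : LinearMap.ker g ≤ LinearMap.ker (LinearMap.toSpanSingleton R R r) := by
    intro a ha
    have ha' : a • m = 0 := by simpa [g] using ha
    have hann : a ∈ Module.annihilator R M := by
      refine Module.mem_annihilator.mpr fun x => ?_
      obtain ⟨b, rfl⟩ := hg x
      simp [g, smul_comm a b, ha']
    simpa [mul_comm] using Submodule.mem_annihilator.mp hr a hann
  let f : M →ₗ[R] R :=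
    (Submodule.liftQ _ _ hker) ∘ₗ (g.quotKerEquivOfSurjective hg).symm.toLinearMap
  have hf : f (g 1) = r := by
    have h : (g.quotKerEquivOfSurjective hg).symm (g 1) = Submodule.Quotient.mk 1 :=
      (LinearEquiv.symm_apply_eq _).mpr rfl
    change Submodule.liftQ _ _ hker ((g.quotKerEquivOfSurjective hg).symm (g 1)) = r
    rw [h, Submodule.liftQ_apply, LinearMap.toSpanSingleton_apply, one_smul]
  exact le_iSup (fun f : M →ₗ[R] R => LinearMap.range f) f ⟨g 1, hf⟩

theorem stmt_3 (R : Type u) [CommRing R] [IsNoetherianRing R]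
    (M : Type v) [AddCommGroup M] [Module R M]
    (hcyc : ∃ m : M, Submodule.span R {m} = ⊤) :
    traceIdeal R M = (Module.annihilator R M).annihilator := by
  obtain ⟨m, hm⟩ := hcyc
  exact le_antisymm (traceIdeal_le_annihilator_annihilator R M)
    (annihilator_annihilator_le_traceIdeal hm)
end

section
/- Let R be a commutative Noetherian ring and I an ideal of R. If I = Ann_R(Ann_R(I)), then I is a trace ideal, i.e., I = τ_R(N) for some R-module N (indeed I = τ_R(I)). -/
universe u v

/-- Any ideal is contained in its trace ideal. -/
theorem Ideal.le_traceIdeal {R : Type u} [CommRing R] (I : Ideal R) : I ≤ traceIdeal R I := by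
  refine le_trans ?_ (le_iSup _ (Submodule.subtype I))
  rw [Submodule.range_subtype]

theorem stmt_6 (R : Type u) [CommRing R] [IsNoetherianRing R] (I : Ideal R)
    (h : I = I.annihilator.annihilator) :
    I = traceIdeal R I ∧ I.IsTraceIdeal := by
  have key : I = traceIdeal R I :=
    le_antisymm I.le_traceIdeal ((traceIdeal_le_annihilator_annihilator R I).trans h.ge)
  exact ⟨key, I, inferInstance, inferInstance, key⟩
end

section
/- Let R be a commutative Noetherian ring and J an ideal of R. Then the annihilator ideal Ann_R(J) is a trace ideal of R. -/
universe u v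

/-- The trace ideal of the cyclic module `R ⧸ J` is the annihilator of `J`. -/
theorem traceIdeal_quotient {R : Type u} [CommRing R] (J : Ideal R) :
    traceIdeal R (R ⧸ J) = J.annihilator := by
  refine le_antisymm (iSup_le fun f => ?_) fun r hr => ?_
  · rintro _ ⟨x, rfl⟩
    refine Submodule.mem_annihilator.2 fun j hj => ?_
    obtain ⟨a, rfl⟩ := Submodule.Quotient.mk_surjective J x
    have h : j • (Submodule.Quotient.mk a : R ⧸ J) = 0 := by
      rw [← Submodule.Quotient.mk_smul, Submodule.Quotient.mk_eq_zero]
      exact J.mul_mem_right a hj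
    rw [smul_eq_mul, mul_comm, ← smul_eq_mul, ← map_smul, h, map_zero]
  · have hJ : J ≤ LinearMap.ker (LinearMap.toSpanSingleton R R r) := fun j hj => by
      have h := Submodule.mem_annihilator.1 hr j hj
      simpa [mul_comm] using h
    refine Submodule.mem_iSup_of_mem (J.liftQ _ hJ) ⟨Submodule.Quotient.mk 1, ?_⟩
    rw [Submodule.liftQ_apply, LinearMap.toSpanSingleton_apply, one_smul]

theorem stmt_7 (R : Type u) [CommRing R] [IsNoetherianRing R] (J : Ideal R) :
    J.annihilator.IsTraceIdeal :=
  ⟨R ⧸ J, inferInstance, inferInstance, (traceIdeal_quotient J).symm⟩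
end

section
/- Let R be a commutative ring, X an injective R-module, and M a submodule of X that is stable under every R-endomorphism of X (φ(M) ⊆ M for all φ ∈ End_R(X)). Then M is a trace module in X; in fact every R-linear map φ : M → X has image contained in M, so τ_X(M) = M. -/
universe u v

/-- The trace module of an `R`-module `N` in `X`: the submodule of `X` generated by the
images of all `R`-linear maps `N → X`. -/
def traceSubmodule (R : Type u) [CommRing R] (X : Type v) [AddCommGroup X] [Module R X]
    (N : Type w) [AddCommGroup N] [Module R N] : Submodule R X :=
  ⨆ f : N →ₗ[R] X, LinearMap.range f

theorem stmt_11 (R : Type u) [CommRing R] (X : Type v) [AddCommGroup X] [Module R X]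
    [Module.Injective R X] (M : Submodule R X)
    (h : ∀ φ : X →ₗ[R] X, M.map φ ≤ M) :
    (∀ (φ : M →ₗ[R] X) (m : M), φ m ∈ M) ∧ traceSubmodule R X M = M := by
  have key : ∀ (φ : M →ₗ[R] X) (m : M), φ m ∈ M := by
    intro φ m
    obtain ⟨ψ, hψ⟩ := Module.Injective.out M.subtype M.injective_subtype φ
    rw [← hψ m]
    exact h ψ (Submodule.mem_map_of_mem m.2)
  refine ⟨key, le_antisymm (iSup_le fun f => ?_) ?_⟩
  · rintro _ ⟨m, rfl⟩
    exact key f m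
  · exact M.range_subtype.ge.trans
      (le_iSup (fun f : M →ₗ[R] X => LinearMap.range f) M.subtype)
end

section
/- Let R be a commutative Noetherian local ring with maximal ideal m in which every principal ideal is a trace ideal. Then every element of m is a zerodivisor; in particular, for every r ∈ R one has (r) = Ann_R(Ann_R((r))). -/
universe u v

/-- A trace ideal is stable under every linear map to the ring. -/
theorem Ideal.IsTraceIdeal.map_mem {R : Type u} [CommRing R] {I : Ideal R}
    (hI : I.IsTraceIdeal) (φ : I →ₗ[R] R) (x : I) : φ x ∈ I := by
  obtain ⟨N, _, _, rfl⟩ := hI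
  have range_le (f : N →ₗ[R] R) : LinearMap.range f ≤ traceIdeal R N :=
    le_iSup (fun f : N →ₗ[R] R => LinearMap.range f) f
  have key : traceIdeal R N ≤
      (Submodule.comap φ (traceIdeal R N)).map (traceIdeal R N).subtype := by
    refine iSup_le fun f => ?_
    rintro _ ⟨n, rfl⟩
    let g : N →ₗ[R] traceIdeal R N := f.codRestrict _ fun n => range_le f ⟨n, rfl⟩
    exact ⟨g n, range_le (φ ∘ₗ g) ⟨n, rfl⟩, rfl⟩
  obtain ⟨y, hy, hyx⟩ := key x.2
  rwa [← Subtype.ext hyx]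

/-- If a principal ideal `(r)` is a trace ideal, it contains every element annihilated by the
annihilator of `r`. -/
theorem Ideal.IsTraceIdeal.mem_span_singleton {R : Type u} [CommRing R] {r x : R}
    (hr : (Ideal.span {r}).IsTraceIdeal) (hx : ∀ c : R, c * r = 0 → c * x = 0) :
    x ∈ Ideal.span {r} := by
  let φ : Ideal.span {r} →ₗ[R] R := (LinearPMap.mkSpanSingleton' r x hx).toFun
  have hφ : φ ⟨r, Ideal.mem_span_singleton_self r⟩ = x :=
    LinearPMap.mkSpanSingleton'_apply_self r x hx _
  exact hφ ▸ hr.map_mem φ _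

theorem stmt_12 (R : Type u) [CommRing R] [IsNoetherianRing R] [IsLocalRing R]
    (h : ∀ r : R, (Ideal.span {r}).IsTraceIdeal) :
    (∀ r ∈ IsLocalRing.maximalIdeal R, ∃ s : R, s ≠ 0 ∧ r * s = 0) ∧
      ∀ r : R, Ideal.span {r} = (Ideal.span {r}).annihilator.annihilator := by
  refine ⟨fun r hr => ?_, fun r => le_antisymm ?_ fun x hx => ?_⟩
  · by_contra! hreg
    have h_one : (1 : R) ∈ Ideal.span {r} := (h r).mem_span_singleton fun c hc => by
      by_contra hc'
      exact hreg c (by simpa using hc') (by rw [mul_comm, hc])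
    exact hr (isUnit_of_dvd_one (Ideal.mem_span_singleton.mp h_one))
  · exact fun x hx => Submodule.mem_annihilator.mpr fun y hy => by
      rw [smul_eq_mul, mul_comm]
      exact Submodule.mem_annihilator.mp hy x hx
  · refine (h r).mem_span_singleton fun c hc => ?_
    rw [mul_comm]
    refine Submodule.mem_annihilator.mp hx c ?_
    exact (Submodule.mem_annihilator_span_singleton r c).mpr hc
end

section
/- Let R be a commutative Noetherian local ring in which every principal ideal is a trace ideal. Then R has Krull dimension zero (equivalently, R is Artinian). -/
universe u v

/-- If `(x)` is a trace ideal, then `x` divides every element annihilated by the annihilator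
of `x`. -/
theorem Ideal.IsTraceIdeal.dvd_of_mul_eq_zero {R : Type u} [CommRing R] {x y : R}
    (hx : (Ideal.span {x}).IsTraceIdeal) (h : ∀ a, a * x = 0 → a * y = 0) : x ∣ y := by
  let s := LinearMap.toSpanSingleton R R x
  let t := LinearMap.toSpanSingleton R R y
  have hs : LinearMap.range s = Ideal.span {x} := LinearMap.range_toSpanSingleton x
  let f : LinearMap.range s →ₗ[R] R :=
    (LinearMap.ker s).liftQ t (fun a ha => by simpa [t] using h a (by simpa [s] using ha)) ∘ₗ
      s.quotKerEquivRange.symm.toLinearMap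
  have hf : f ⟨s 1, 1, rfl⟩ = y := by
    have : s.quotKerEquivRange.symm ⟨s 1, 1, rfl⟩ = (LinearMap.ker s).mkQ 1 :=
      s.quotKerEquivRange_symm_apply_image 1 _
    rw [LinearMap.comp_apply, LinearEquiv.coe_coe, this]
    exact one_smul R y
  have := (hs ▸ hx : Ideal.IsTraceIdeal (LinearMap.range s)).apply_mem f ⟨s 1, 1, rfl⟩
  rwa [hf, hs, Ideal.mem_span_singleton] at this

/-- In a Noetherian ring, the annihilators of the powers of an element stabilize. -/
theorem exists_forall_mul_pow_succ_eq_zero {R : Type u} [CommRing R] [IsNoetherianRing R]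
    (x : R) : ∃ n : ℕ, ∀ a, a * x ^ (n + 1) = 0 → a * x ^ n = 0 := by
  let c : ℕ →o Ideal R :=
    { toFun n := LinearMap.ker (LinearMap.toSpanSingleton R R (x ^ n))
      monotone' := monotone_nat_of_le_succ fun n a ha => by
        simp only [LinearMap.mem_ker, LinearMap.toSpanSingleton_apply, smul_eq_mul] at ha ⊢
        rw [pow_succ, ← mul_assoc, ha, zero_mul] }
  obtain ⟨n, hn⟩ := monotone_stabilizes_iff_noetherian.mpr ‹IsNoetherianRing R› c
  refine ⟨n, fun a ha => ?_⟩
  have : a ∈ c n := hn (n + 1) n.le_succ ▸ (by simpa [c] using ha)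
  simpa [c] using this

theorem stmt_13 (R : Type u) [CommRing R] [IsNoetherianRing R] [IsLocalRing R]
    (h : ∀ r : R, (Ideal.span {r}).IsTraceIdeal) :
    ringKrullDim R = 0 := by
  have hnil (x : R) (hx : x ∈ IsLocalRing.maximalIdeal R) : IsNilpotent x := by
    obtain ⟨n, hn⟩ := exists_forall_mul_pow_succ_eq_zero x
    obtain ⟨a, ha⟩ := (h (x ^ (n + 1))).dvd_of_mul_eq_zero hn
    have hu : IsUnit (1 - x * a) :=
      IsLocalRing.isUnit_one_sub_self_of_mem_nonunits _
        ((IsLocalRing.mem_maximalIdeal _).mp (Ideal.mul_mem_right a _ hx))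
    exact ⟨n, hu.mul_left_eq_zero.mp (by linear_combination ha)⟩
  refine ringKrullDimZero_iff_ringKrullDim_eq_zero.mp (Ring.KrullDimLE.mk₀ fun P hP => ?_)
  have hle : IsLocalRing.maximalIdeal R ≤ P := fun x hx => by
    obtain ⟨n, hn⟩ := hnil x hx
    exact hP.mem_of_pow_mem n (hn ▸ P.zero_mem)
  rw [← (IsLocalRing.maximalIdeal.isMaximal R).eq_of_le hP.ne_top hle]
  exact IsLocalRing.maximalIdeal.isMaximal R
end
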